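/- Let E be a real Banach space, D ⊊ E a domain, and γ a c₀-neargeodesic (c₀ ≥ 1) in D joining x and y. Suppose there is a constant A ≥ 1 such that whenever z₁, z₂ ∈ γ are points for which every w ∈ γ[z₁,z₂] satisfies Δ(w) ≤ 2·min{Δ(z₁), Δ(z₂)}, then k_D(z₁,z₂) ≤ A. Then γ is a C-cone arc with C = 3·e^{2c₀A}. -/

import Mathlib

open Set Metric

noncomputable section

variable {E : Type*} [NormedAddCommGroup E] [NormedSpace ℝ E]

/-- `deltaBd D z` is the distance `Δ(z)` from `z` to the boundary `∂D`. -/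
def deltaBd (D : Set E) (z : E) : ℝ := Metric.infDist z (frontier D)

/-- `γ` is a rectifiable curve in `D`, parametrized by (norm) arclength on `[0, L]`:
it maps `[0, L]` into `D` and the length of the subarc `γ[γ s, γ t]` equals `t - s`. -/
def IsArcLengthParam (D : Set E) (γ : ℝ → E) (L : ℝ) : Prop :=
  0 ≤ L ∧ (∀ t ∈ Icc (0 : ℝ) L, γ t ∈ D) ∧
    ∀ s t : ℝ, 0 ≤ s → s ≤ t → t ≤ L →
      eVariationOn γ (Icc s t) = ENNReal.ofReal (t - s)

/-- The quasihyperbolic length `l_k(γ[γ a, γ b]) = ∫ ds / Δ` of the subarc between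
parameters `a` and `b` of an arclength-parametrized curve `γ` in `D`. -/
def qhLength (D : Set E) (γ : ℝ → E) (a b : ℝ) : ℝ :=
  ∫ t in a..b, 1 / deltaBd D (γ t)

/-- The quasihyperbolic metric `k_D(x,y)`: the infimum of quasihyperbolic lengths of
rectifiable curves in `D` joining `x` and `y`. -/
def qhDist (D : Set E) (x y : E) : ℝ :=
  sInf { l : ℝ | ∃ γ : ℝ → E, ∃ L : ℝ, IsArcLengthParam D γ L ∧
    γ 0 = x ∧ γ L = y ∧ l = qhLength D γ 0 L }

/-- An arclength-parametrized curve `γ : [0,L] → D` joining `x = γ 0` and `y = γ L` is a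
`b`-cone arc if `min (l (γ[x,z])) (l (γ[z,y])) ≤ b * Δ z` for every point `z = γ t` on `γ`. -/
def IsConeArc (D : Set E) (γ : ℝ → E) (L b : ℝ) : Prop :=
  ∀ t ∈ Icc (0 : ℝ) L, min t (L - t) ≤ b * deltaBd D (γ t)

/-- `D` is a `c`-John domain: every pair of points of `D` can be joined by a `c`-cone arc. -/
def IsJohnDomain (D : Set E) (c : ℝ) : Prop :=
  ∀ x ∈ D, ∀ y ∈ D, ∃ γ : ℝ → E, ∃ L : ℝ,
    IsArcLengthParam D γ L ∧ γ 0 = x ∧ γ L = y ∧ IsConeArc D γ L c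

/-- A curve `γ` in `D` is a `c₀`-neargeodesic if `l_k(γ[x,y]) ≤ c₀ * k_D(x,y)` for all
points `x, y` on `γ`. -/
def IsNeargeodesic (D : Set E) (γ : ℝ → E) (L c₀ : ℝ) : Prop :=
  IsArcLengthParam D γ L ∧
    ∀ s t : ℝ, 0 ≤ s → s ≤ t → t ≤ L →
      qhLength D γ s t ≤ c₀ * qhDist D (γ s) (γ t)

/-- The Gromov product `(x|y)_p` with respect to the quasihyperbolic metric on `D`. -/
def gromovProd (D : Set E) (p x y : E) : ℝ :=
  (qhDist D x p + qhDist D y p - qhDist D x y) / 2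

/-- `(D, k_D)` is Gromov `δ`-hyperbolic. -/
def IsGromovHyperbolic (D : Set E) (δ : ℝ) : Prop :=
  ∀ x ∈ D, ∀ y ∈ D, ∀ z ∈ D, ∀ p ∈ D,
    min (gromovProd D p x y) (gromovProd D p y z) - δ ≤ gromovProd D p x z

end

theorem exists_first_eq {f : ℝ → ℝ} {a b m : ℝ} (hab : a ≤ b) (hf : ContinuousOn f (Icc a b))
    (ha : f a ≤ m) (hb : m ≤ f b) :
    ∃ q ∈ Icc a b, f q = m ∧ ∀ w ∈ Icc a q, f w ≤ m := by
  have hne : (Icc a b ∩ f ⁻¹' {m}).Nonempty := by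
    obtain ⟨q, hq, hqm⟩ := intermediate_value_Icc hab hf ⟨ha, hb⟩
    exact ⟨q, hq, hqm⟩
  have hcpt : IsCompact (Icc a b ∩ f ⁻¹' {m}) :=
    isCompact_Icc.of_isClosed_subset
      (hf.preimage_isClosed_of_isClosed isClosed_Icc isClosed_singleton) inter_subset_left
  obtain ⟨q, ⟨hq, hqm⟩, hmin⟩ := hcpt.exists_isLeast hne
  refine ⟨q, hq, hqm, fun w hw => ?_⟩
  by_contra! hlt
  obtain ⟨p, hp, hpm⟩ := intermediate_value_Icc hw.1
    (hf.mono (Icc_subset_Icc_right (hw.2.trans hq.2))) ⟨ha, hlt.le⟩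
  have hqp : q ≤ p := hmin ⟨⟨hp.1, hp.2.trans (hw.2.trans hq.2)⟩, hpm⟩
  have hqw : q = w := le_antisymm (hqp.trans hp.2) hw.2
  rw [← hqw] at hlt
  exact hlt.ne' hqm

theorem sub_div_le_integral_one_div {f : ℝ → ℝ} {s t m : ℝ} (hst : s ≤ t)
    (hf : ContinuousOn f (Icc s t)) (hpos : ∀ w ∈ Icc s t, 0 < f w)
    (hm : ∀ w ∈ Icc s t, f w ≤ m) :
    (t - s) / m ≤ ∫ w in s..t, 1 / f w := by
  have h := intervalIntegral.integral_mono_on (f := fun _ => 1 / m) (g := fun w => 1 / f w)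
    (μ := MeasureTheory.volume) hst intervalIntegrable_const
    (ContinuousOn.intervalIntegrable_of_Icc hst
      (continuousOn_const.div hf fun w hw => (hpos w hw).ne'))
    fun w hw => one_div_le_one_div_of_le (hpos w hw) (hm w hw)
  simpa [div_eq_mul_inv] using h

theorem log_le_integral_one_div {f : ℝ → ℝ} {s t : ℝ} (hst : s ≤ t)
    (hf : ContinuousOn f (Icc s t)) (hpos : ∀ w ∈ Icc s t, 0 < f w)
    (hlip : ∀ w ∈ Icc s t, f w ≤ f t + (t - w)) :
    Real.log (f s / f t) ≤ ∫ w in s..t, 1 / f w := by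
  have ht := hpos t ⟨hst, le_rfl⟩
  have hlow : ∀ w ∈ Icc s t, 0 < f t + (t - w) := fun w hw => by linarith [hw.2]
  have hval : ∫ w in s..t, 1 / (f t + (t - w)) = Real.log ((f t + (t - s)) / f t) := by
    have h := intervalIntegral.integral_comp_sub_left (fun v => 1 / v) (f t + t)
      (a := s) (b := t)
    rw [integral_one_div_of_pos (by linarith) (by linarith)] at h
    calc _ = ∫ w in s..t, 1 / (f t + t - w) := by simp only [add_sub_assoc]
      _ = _ := by rw [h]; congr 2 <;> ring
  calc Real.log (f s / f t) ≤ Real.log ((f t + (t - s)) / f t) := by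
        have hs := hpos s ⟨le_rfl, hst⟩
        exact Real.log_le_log (by positivity)
          (div_le_div_of_nonneg_right (hlip s ⟨le_rfl, hst⟩) ht.le)
    _ ≤ _ := by
        rw [← hval]
        exact intervalIntegral.integral_mono_on hst
          (ContinuousOn.intervalIntegrable_of_Icc hst
            (continuousOn_const.div (by fun_prop) fun w hw => (hlow w hw).ne'))
          (ContinuousOn.intervalIntegrable_of_Icc hst
            (continuousOn_const.div hf fun w hw => (hpos w hw).ne'))
          fun w hw => one_div_le_one_div_of_le (hpos w hw) (hlip w hw)

/-- If `∫ 1 / f ≤ u` over every interval on which `f` is at most twice its smaller end value, then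
a point `s` at which `f` attains its maximum over `[0, s]` satisfies `s ≤ 2 * u * f s`. -/
theorem le_two_mul_of_forall_le {f : ℝ → ℝ} {T u : ℝ} (hu : 0 ≤ u)
    (hf : ContinuousOn f (Icc 0 T)) (hpos : ∀ w ∈ Icc 0 T, 0 < f w)
    (hfu : ∀ s t : ℝ, 0 ≤ s → s ≤ t → t ≤ T →
      (∀ w ∈ Icc s t, f w ≤ 2 * min (f s) (f t)) → ∫ w in s..t, 1 / f w ≤ u)
    {s : ℝ} (hs : s ∈ Icc 0 T) (hmax : ∀ w ∈ Icc 0 s, f w ≤ f s) : s ≤ 2 * u * f s := by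
  have key : ∀ r s, 0 ≤ r → r ≤ s → s ≤ T → (∀ w ∈ Icc r s, f w ≤ f s) → f s ≤ 2 * f r →
      s - r ≤ u * f s := by
    intro r s hr hrs hsT hle hfr
    have hsub : Icc r s ⊆ Icc 0 T := Icc_subset_Icc hr hsT
    have h1 := sub_div_le_integral_one_div hrs (hf.mono hsub) (fun w hw => hpos w (hsub hw)) hle
    have h2 := hfu r s hr hrs hsT fun w hw => by
      rw [min_eq_left (hle r ⟨le_rfl, hrs⟩)]
      exact (hle w hw).trans hfr
    exact (div_le_iff₀ (hpos s ⟨hr.trans hrs, hsT⟩)).1 (h1.trans h2)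
  have h0 : (0 : ℝ) ∈ Icc 0 T := ⟨le_rfl, hs.1.trans hs.2⟩
  obtain ⟨n, hn⟩ : ∃ n : ℕ, f s ≤ 2 ^ n * f 0 := by
    obtain ⟨n, hn⟩ := pow_unbounded_of_one_lt (f s / f 0) one_lt_two
    exact ⟨n, ((div_lt_iff₀ (hpos 0 h0)).1 hn).le⟩
  induction n generalizing s with
  | zero =>
    have := key 0 s le_rfl hs.1 hs.2 hmax (by linarith [hpos 0 h0])
    nlinarith [mul_nonneg hu (hpos s hs).le]
  | succ n ih =>
    have hfs := hpos s hs
    by_cases hc : f s ≤ 2 * f 0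
    · nlinarith [key 0 s le_rfl hs.1 hs.2 hmax hc, mul_nonneg hu hfs.le]
    · obtain ⟨r, hr, hrm, hrmax⟩ := exists_first_eq (m := f s / 2) hs.1
        (hf.mono (Icc_subset_Icc_right hs.2)) (by linarith) (by linarith)
      have h1 := key r s hr.1 hr.2 hs.2 (fun w hw => hmax w ⟨hr.1.trans hw.1, hw.2⟩)
        (by linarith)
      have h2 : r ≤ 2 * u * f r :=
        ih ⟨hr.1, hr.2.trans hs.2⟩ (fun w hw => hrm ▸ hrmax w hw) (by
          rw [pow_succ] at hn
          linarith)
      rw [hrm] at h2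
      linarith

theorem continuousOn_of_forall_le_add_abs {f : ℝ → ℝ} {S : Set ℝ}
    (hf : ∀ s ∈ S, ∀ t ∈ S, f s ≤ f t + |s - t|) : ContinuousOn f S :=
  (LipschitzOnWith.of_le_add_mul 1 fun s hs t ht => by
    simpa [Real.dist_eq] using hf s hs t ht).continuousOn

/-- Cone estimate for a positive `1`-Lipschitz function on `[0, T]` attaining its maximum at `T`,
if `∫ 1 / f ≤ u` over every interval on which `f` is at most twice its smaller end value. -/
theorem le_mul_of_isMaxOn_right {f : ℝ → ℝ} {T u : ℝ} (hu : 1 ≤ u)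
    (hpos : ∀ w ∈ Icc 0 T, 0 < f w)
    (hlip : ∀ s ∈ Icc 0 T, ∀ t ∈ Icc 0 T, f s ≤ f t + |s - t|)
    (hmax : ∀ w ∈ Icc 0 T, f w ≤ f T)
    (hfu : ∀ s t : ℝ, 0 ≤ s → s ≤ t → t ≤ T →
      (∀ w ∈ Icc s t, f w ≤ 2 * min (f s) (f t)) → ∫ w in s..t, 1 / f w ≤ u)
    {t : ℝ} (ht : t ∈ Icc 0 T) : t ≤ 3 * Real.exp (2 * u) * f t := by
  have hf : ContinuousOn f (Icc 0 T) := continuousOn_of_forall_le_add_abs hlip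
  obtain ⟨r, hr, hrmax⟩ := isCompact_Icc.exists_isMaxOn (nonempty_Icc.2 ht.1)
    (hf.mono (Icc_subset_Icc_right ht.2))
  have hrle : ∀ w ∈ Icc 0 t, f w ≤ f r := fun w hw => hrmax hw
  have hrT : r ∈ Icc 0 T := ⟨hr.1, hr.2.trans ht.2⟩
  have hft := hpos t ht
  have hfr := hpos r hrT
  have h1 : r ≤ 2 * u * f r := le_two_mul_of_forall_le (by linarith) hf hpos hfu hrT
    fun w hw => hrle w ⟨hw.1, hw.2.trans hr.2⟩
  obtain ⟨q, hq, hqm, hqle⟩ := exists_first_eq (m := f r) ht.2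
    (hf.mono (Icc_subset_Icc_left ht.1)) (hrle t ⟨ht.1, le_rfl⟩) (hmax r hrT)
  have hrq : ∀ w ∈ Icc r q, 0 < f w := fun w hw => hpos w ⟨hr.1.trans hw.1, hw.2.trans hq.2⟩
  have hcont : ContinuousOn f (Icc r q) := hf.mono (Icc_subset_Icc hr.1 hq.2)
  have h2 : ∫ w in r..q, 1 / f w ≤ u := hfu r q hr.1 (hr.2.trans hq.1) hq.2 fun w hw => by
    rw [hqm, min_self]
    rcases le_total w t with h | h
    · linarith [hrle w ⟨hr.1.trans hw.1, h⟩]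
    · linarith [hqle w ⟨h, hw.2⟩]
  have h3 : ∫ w in r..t, 1 / f w ≤ u := by
    refine le_trans (intervalIntegral.integral_mono_interval le_rfl hr.2 hq.1 ?_ ?_) h2
    · filter_upwards [MeasureTheory.ae_restrict_mem measurableSet_Ioc] with w hw
      exact (one_div_pos.2 (hrq w (Ioc_subset_Icc_self hw))).le
    · exact ContinuousOn.intervalIntegrable_of_Icc (hr.2.trans hq.1)
        (continuousOn_const.div hcont fun w hw => (hrq w hw).ne')
  have hcont' : ContinuousOn f (Icc r t) := hcont.mono (Icc_subset_Icc_right hq.1)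
  have hpos' : ∀ w ∈ Icc r t, 0 < f w := fun w hw => hrq w ⟨hw.1, hw.2.trans hq.1⟩
  have h4 : t - r ≤ u * f r := (div_le_iff₀ hfr).1 <|
    (sub_div_le_integral_one_div hr.2 hcont' hpos' fun w hw =>
      hrle w ⟨hr.1.trans hw.1, hw.2⟩).trans h3
  have h5 : f r ≤ Real.exp u * f t := by
    have hlog : Real.log (f r / f t) ≤ u := (log_le_integral_one_div hr.2 hcont' hpos'
      fun w hw => by
        have h := hlip w ⟨hr.1.trans hw.1, hw.2.trans ht.2⟩ t ht
        rwa [abs_sub_comm, abs_of_nonneg (sub_nonneg.2 hw.2)] at h).trans h3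
    exact (div_le_iff₀ hft).1 ((Real.log_le_iff_le_exp (by positivity)).1 hlog)
  have hue : u ≤ Real.exp u := by linarith [Real.add_one_le_exp u]
  calc t ≤ 3 * u * f r := by linarith
    _ ≤ 3 * Real.exp u * (Real.exp u * f t) := by gcongr
    _ = 3 * Real.exp (2 * u) * f t := by rw [two_mul u, Real.exp_add]; ring

theorem deltaBd_pos {E : Type*} [NormedAddCommGroup E] [NormedSpace ℝ E] {D : Set E}
    (hD : IsOpen D) (hne : D ≠ univ) {z : E} (hz : z ∈ D) : 0 < deltaBd D z := by
  have hfr : (frontier D).Nonempty := nonempty_frontier_iff.2 ⟨⟨z, hz⟩, hne⟩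
  refine (isClosed_frontier.notMem_iff_infDist_pos hfr).1 fun h => ?_
  rw [hD.frontier_eq] at h
  exact h.2 hz

theorem IsArcLengthParam.dist_le {E : Type*} [NormedAddCommGroup E] [NormedSpace ℝ E] {D : Set E}
    {γ : ℝ → E} {L : ℝ} (hγ : IsArcLengthParam D γ L) {s t : ℝ} (hs : s ∈ Icc 0 L)
    (ht : t ∈ Icc 0 L) : dist (γ s) (γ t) ≤ |s - t| := by
  wlog hst : s ≤ t generalizing s t
  · rw [dist_comm, abs_sub_comm]
    exact this ht hs (le_of_not_ge hst)
  have h := eVariationOn.edist_le γ (left_mem_Icc.2 hst) (right_mem_Icc.2 hst)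
  rw [hγ.2.2 s t hs.1 hst ht.2, edist_dist,
    ENNReal.ofReal_le_ofReal_iff (sub_nonneg.2 hst)] at h
  rwa [abs_sub_comm, abs_of_nonneg (sub_nonneg.2 hst)]

/-- Let `E` be a real Banach space, `D ⊊ E` a domain, and `γ` a
`c₀`-neargeodesic (`c₀ ≥ 1`) in `D` joining `x` and `y`. Suppose there is a constant `A ≥ 1`
such that whenever `z₁ = γ s`, `z₂ = γ t` are points on `γ` for which every `w ∈ γ[z₁,z₂]`
satisfies `Δ(w) ≤ 2 * min (Δ z₁) (Δ z₂)`, then `k_D(z₁,z₂) ≤ A`.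
Then `γ` is a `C`-cone arc with `C = 3 * exp (2 * c₀ * A)`. -/
theorem neargeodesic_is_cone_arc_of_qhDist_bound
    {E : Type*} [NormedAddCommGroup E] [NormedSpace ℝ E] [CompleteSpace E]
    (D : Set E) (hD : IsOpen D) (hconn : IsConnected D) (hne : D ≠ Set.univ)
    (c₀ : ℝ) (hc₀ : 1 ≤ c₀) (γ : ℝ → E) (L : ℝ) (x y : E)
    (hγ : IsNeargeodesic D γ L c₀) (hx : γ 0 = x) (hy : γ L = y)
    (A : ℝ) (hA : 1 ≤ A)
    (hyp : ∀ s t : ℝ, 0 ≤ s → s ≤ t → t ≤ L →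
      (∀ w ∈ Icc s t, deltaBd D (γ w) ≤ 2 * min (deltaBd D (γ s)) (deltaBd D (γ t))) →
      qhDist D (γ s) (γ t) ≤ A) :
    IsConeArc D γ L (3 * Real.exp (2 * c₀ * A)) := by
  obtain ⟨harc, hnear⟩ := hγ
  have hu : 1 ≤ c₀ * A := one_le_mul_of_one_le_of_one_le hc₀ hA
  set f : ℝ → ℝ := fun t => deltaBd D (γ t)
  have hpos : ∀ t ∈ Icc 0 L, 0 < f t := fun t ht => deltaBd_pos hD hne (harc.2.1 t ht)
  have hlip : ∀ s ∈ Icc 0 L, ∀ t ∈ Icc 0 L, f s ≤ f t + |s - t| := fun s hs t ht =>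
    infDist_le_infDist_add_dist.trans (add_le_add_right (harc.dist_le hs ht) _)
  have hfu : ∀ s t : ℝ, 0 ≤ s → s ≤ t → t ≤ L →
      (∀ w ∈ Icc s t, f w ≤ 2 * min (f s) (f t)) → ∫ w in s..t, 1 / f w ≤ c₀ * A :=
    fun s t hs hst htL h => (hnear s t hs hst htL).trans
      (mul_le_mul_of_nonneg_left (hyp s t hs hst htL h) (by linarith))
  have hcont : ContinuousOn f (Icc 0 L) := continuousOn_of_forall_le_add_abs hlip
  obtain ⟨T, hT, hTmax⟩ := isCompact_Icc.exists_isMaxOn (nonempty_Icc.2 harc.1) hcont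
  intro t ht
  rw [mul_assoc 2 c₀ A]
  rcases le_total t T with htT | hTt
  · have hsub : Icc 0 T ⊆ Icc 0 L := Icc_subset_Icc_right hT.2
    exact (min_le_left _ _).trans <| le_mul_of_isMaxOn_right hu (fun w hw => hpos w (hsub hw))
      (fun s hs t ht => hlip s (hsub hs) t (hsub ht)) (fun w hw => hTmax (hsub hw))
      (fun s t hs hst htT => hfu s t hs hst (htT.trans hT.2)) ⟨ht.1, htT⟩
  · have hrefl : ∀ w ∈ Icc 0 (L - T), L - w ∈ Icc 0 L := fun w hw =>
      ⟨by linarith [hw.2, hT.1], by linarith [hw.1]⟩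
    have h := le_mul_of_isMaxOn_right (f := fun w => f (L - w)) (T := L - T) (t := L - t) hu
      (fun w hw => hpos _ (hrefl w hw))
      (fun p hp q hq => by
        have h := hlip _ (hrefl p hp) _ (hrefl q hq)
        rwa [sub_sub_sub_cancel_left, abs_sub_comm] at h)
      (fun w hw => by
        simp only [sub_sub_cancel]
        exact hTmax (hrefl w hw))
      (fun p q hp hpq hq hle => by
        rw [intervalIntegral.integral_comp_sub_left (fun w => 1 / f w) L]
        refine hfu _ _ (by linarith [hT.1]) (by linarith) (by linarith) fun w hw => ?_
        have := hle (L - w) ⟨by linarith [hw.2], by linarith [hw.1]⟩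
        rwa [sub_sub_cancel, min_comm] at this)
      ⟨by linarith [ht.2], by linarith⟩
    simp only [sub_sub_cancel] at h
    exact (min_le_right _ _).trans h
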